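/- Let (Ω, ℱ, P) be a probability space and let ℰ : L^∞(ℱ) → ℝ be a lower semicontinuous convex expectation, i.e. ℰ satisfies strict monotonicity, constant triviality (ℰ(c) = c for constants c), translation equivariance (ℰ(ξ + c) = ℰ(ξ) + c), convexity, and lower semicontinuity (ξ_n ↑ ξ pointwise implies ℰ(ξ_n) ↑ ℰ(ξ)). Then there exists a penalty function α : ℳ₁ → [0, ∞] on the set ℳ₁ of probability measures absolutely continuous with respect to P such that ℰ(ξ) = sup_{Q ∈ ℳ₁} { E_Q[ξ] − α(Q) } for all ξ ∈ L^∞(ℱ); moreover there is a minimal such penalty, given by α_min(Q) = sup_{ξ ∈ L^∞(ℱ)} { E_Q[ξ] − ℰ(ξ) }. -/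

import Mathlib

/-!
STATEMENT 0: a lower semicontinuous convex expectation on `L^∞` of a
probability space admits a representation
`ℰ(ξ) = sup_{Q ∈ ℳ₁} { E_Q[ξ] − α(Q) }` over the probability measures
absolutely continuous with respect to `P`, with a minimal penalty
`α_min(Q) = sup_{ξ ∈ L^∞} { E_Q[ξ] − ℰ(ξ) }`.
-/

open MeasureTheory Filter ENNReal

/-- Membership in `L^∞(ℱ)`: (everywhere) bounded measurable functions. -/
def MemLinf {Ω : Type*} [MeasurableSpace Ω] (ξ : Ω → ℝ) : Prop :=
  Measurable ξ ∧ ∃ C : ℝ, ∀ ω, |ξ ω| ≤ C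


lemma nested_convex {H : Type*} [NormedAddCommGroup H] [InnerProductSpace ℝ H] [CompleteSpace H]
    (D : ℕ → Set H) (hc : ∀ n, IsClosed (D n)) (hconv : ∀ n, Convex ℝ (D n))
    (hanti : Antitone D) (hne : ∀ n, (D n).Nonempty) (R : ℝ) (hR : ∀ n, ∀ x ∈ D n, ‖x‖ ≤ R) :
    ∃ x, ∀ n, x ∈ D n := by
  have h1 : ∀ n, ∃ v ∈ D n, ∀ w ∈ D n, ‖v‖ ≤ ‖w‖ := by
    intro n
    obtain ⟨v, hv, hv2⟩ := exists_norm_eq_iInf_of_complete_convex (hne n) (hc n).isComplete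
      (hconv n) 0
    refine ⟨v, hv, fun w hw => ?_⟩
    simp only [zero_sub, norm_neg] at hv2
    rw [hv2]
    exact ciInf_le (f := fun w : D n => ‖(w : H)‖)
      ⟨0, Set.forall_mem_range.2 fun _ => norm_nonneg _⟩ ⟨w, hw⟩
  choose f hf hmin using h1
  have hm : Monotone (fun n => ‖f n‖ ^ 2) := by
    intro n m hnm
    have := hmin n (f m) (hanti hnm (hf m))
    dsimp only
    gcongr
  have hb : BddAbove (Set.range fun n => ‖f n‖ ^ 2) := by
    refine ⟨R ^ 2, ?_⟩
    rintro _ ⟨n, rfl⟩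
    have := hR n _ (hf n)
    dsimp only
    gcongr
  have hcau := (tendsto_atTop_ciSup hm hb).cauchySeq
  have key : ∀ n m, n ≤ m → ‖f n - f m‖ ^ 2 ≤ 2 * (‖f m‖ ^ 2 - ‖f n‖ ^ 2) := by
    intro n m hnm
    have hmid : (1 / 2 : ℝ) • f n + (1 / 2 : ℝ) • f m ∈ D n :=
      hconv n (hf n) (hanti hnm (hf m)) (by norm_num) (by norm_num) (by norm_num)
    have h2 := hmin n _ hmid
    rw [← smul_add, norm_smul] at h2
    norm_num at h2
    have h3 : (2 * ‖f n‖) ^ 2 ≤ ‖f n + f m‖ ^ 2 := by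
      have : 2 * ‖f n‖ ≤ ‖f n + f m‖ := by linarith
      gcongr
    have h4 := parallelogram_law_with_norm ℝ (f n) (f m)
    nlinarith
  have hcf : CauchySeq f := by
    rw [Metric.cauchySeq_iff'] at hcau ⊢
    intro e he
    obtain ⟨N, hN⟩ := hcau (e ^ 2 / 2) (by positivity)
    refine ⟨N, fun n hn => ?_⟩
    have h5 := hN n hn
    rw [Real.dist_eq] at h5
    have h6 := key N n hn
    have h7 := (abs_lt.1 h5).2
    rw [dist_comm, dist_eq_norm]
    refine lt_of_pow_lt_pow_left₀ 2 he.le ?_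
    linarith
  obtain ⟨x, hx⟩ := cauchySeq_tendsto_of_complete hcf
  refine ⟨x, fun n => (hc n).mem_of_tendsto hx ?_⟩
  filter_upwards [eventually_ge_atTop n] with m hm
  exact hanti hm (hf m)

lemma sep_hilbert {H : Type*} [NormedAddCommGroup H] [InnerProductSpace ℝ H] [CompleteSpace H]
    (K B : Set H) (hK : IsClosed K) (hKc : Convex ℝ K) (R : ℝ) (hR : ∀ x ∈ K, ‖x‖ ≤ R)
    (hB : IsClosed B) (hBc : Convex ℝ B) (hdis : Disjoint K B) :
    ∃ (g : H) (u : ℝ), (∀ b ∈ B, inner ℝ g b < u) ∧ ∀ k ∈ K, u ≤ inner ℝ g k := by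
  have h1 : ∃ n : ℕ, K ∩ Metric.cthickening (1 / ((n : ℝ) + 1)) B = ∅ := by
    by_contra! hcon
    obtain ⟨x, hx⟩ := nested_convex (fun n : ℕ => K ∩ Metric.cthickening (1 / ((n : ℝ) + 1)) B)
      (fun n => hK.inter Metric.isClosed_cthickening)
      (fun n => hKc.inter (hBc.cthickening _))
      (fun n m hnm => Set.inter_subset_inter_right _ (Metric.cthickening_mono (by
        apply one_div_le_one_div_of_le (by positivity); gcongr) _))
      hcon R (fun n x hx => hR x hx.1)
    refine Set.disjoint_left.1 hdis (hx 0).1 ?_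
    have : x ∈ closure B := by
      rw [Metric.closure_eq_iInter_cthickening]
      simp only [Set.mem_iInter]
      intro d hd
      obtain ⟨n, hn⟩ := exists_nat_one_div_lt hd
      exact Metric.cthickening_mono hn.le _ (hx n).2
    rwa [hB.closure_eq] at this
  obtain ⟨n, hn⟩ := h1
  have hpos : (0 : ℝ) < 1 / ((n : ℝ) + 1) := by positivity
  obtain ⟨φ, u, h2, h3⟩ := geometric_hahn_banach_open (hBc.thickening (1 / ((n : ℝ) + 1)))
    Metric.isOpen_thickening hKc (by
      rw [Set.disjoint_left]
      intro a ha ha'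
      have : a ∈ K ∩ Metric.cthickening (1 / ((n : ℝ) + 1)) B :=
        ⟨ha', Metric.thickening_subset_cthickening _ _ ha⟩
      rw [hn] at this
      exact this)
  refine ⟨(InnerProductSpace.toDual ℝ H).symm φ, u, fun b hb => ?_, fun k hk => ?_⟩
  · rw [InnerProductSpace.toDual_symm_apply]
    exact h2 b (Metric.self_subset_thickening hpos _ hb)
  · rw [InnerProductSpace.toDual_symm_apply]
    exact h3 k hk



lemma fatou_seq {Ω : Type*} [MeasurableSpace Ω] (ℰ : (Ω → ℝ) → ℝ)
    (hmono : ∀ ξ₁ ξ₂ : Ω → ℝ, MemLinf ξ₁ → MemLinf ξ₂ → (ξ₂ ≤ ξ₁) → ℰ ξ₂ ≤ ℰ ξ₁)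
    (hlsc : ∀ (ξs : ℕ → Ω → ℝ) (ξ : Ω → ℝ), (∀ n, MemLinf (ξs n)) → MemLinf ξ →
      (∀ ω, Monotone fun n => ξs n ω) →
      (∀ ω, Tendsto (fun n => ξs n ω) atTop (nhds (ξ ω))) →
        Tendsto (fun n => ℰ (ξs n)) atTop (nhds (ℰ ξ)))
    (η : ℕ → Ω → ℝ) (hη : ∀ n, Measurable (η n)) (R c : ℝ) (hR : ∀ n ω, |η n ω| ≤ R)
    (hc : ∀ n, ℰ (η n) ≤ c) :
    ∃ ζ : Ω → ℝ, MemLinf ζ ∧ ℰ ζ ≤ c ∧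
      ∀ ω x, Tendsto (fun n => η n ω) atTop (nhds x) → ζ ω = x := by
  let m : ℕ → Ω → ℝ := fun n ω => ⨅ i, η (n + i) ω
  have hbb : ∀ n ω, BddBelow (Set.range fun i => η (n + i) ω) := fun n ω =>
    ⟨-R, by rintro _ ⟨i, rfl⟩; exact (abs_le.1 (hR _ ω)).1⟩
  have hmle : ∀ n i ω, m n ω ≤ η (n + i) ω := fun n i ω => ciInf_le (hbb n ω) i
  have hlem : ∀ n ω y, (∀ i, y ≤ η (n + i) ω) → y ≤ m n ω := fun n ω y h => le_ciInf h
  have hmR : ∀ n ω, |m n ω| ≤ R := fun n ω => abs_le.2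
    ⟨hlem n ω _ fun i => (abs_le.1 (hR _ ω)).1, (hmle n 0 ω).trans (abs_le.1 (hR _ ω)).2⟩
  have hmm : ∀ n, Measurable (m n) := fun n => Measurable.iInf fun i => hη _
  have hmmono : ∀ ω, Monotone fun n => m n ω := by
    intro ω n k hnk
    refine hlem k ω _ fun i => ?_
    have := hmle n (k - n + i) ω
    rwa [show n + (k - n + i) = k + i by omega] at this
  have hbd : ∀ ω, BddAbove (Set.range fun n => m n ω) := fun ω =>
    ⟨R, by rintro _ ⟨i, rfl⟩; exact (abs_le.1 (hmR _ ω)).2⟩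
  let ζ : Ω → ℝ := fun ω => ⨆ n, m n ω
  have hlim : ∀ ω, Tendsto (fun n => m n ω) atTop (nhds (ζ ω)) := fun ω =>
    tendsto_atTop_ciSup (hmmono ω) (hbd ω)
  have hζ : MemLinf ζ := ⟨Measurable.iSup hmm, R, fun ω =>
    le_of_tendsto' (hlim ω).abs fun n => hmR n ω⟩
  refine ⟨ζ, hζ, ?_, ?_⟩
  · refine le_of_tendsto' (hlsc m ζ (fun n => ⟨hmm n, R, hmR n⟩) hζ hmmono hlim) fun n => ?_
    exact (hmono (η n) (m n) ⟨hη n, R, hR n⟩ ⟨hmm n, R, hmR n⟩ (fun ω => hmle n 0 ω)).trans (hc n)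
  · intro ω x hx
    refine le_antisymm (le_of_tendsto_of_tendsto' (hlim ω) hx fun n => hmle n 0 ω) ?_
    refine le_of_forall_pos_le_add fun e he => ?_
    have := hx.eventually (eventually_ge_nhds (show x - e < x by linarith))
    obtain ⟨N, hN⟩ := eventually_atTop.1 this
    have h1 : x - e ≤ m N ω := hlem N ω _ fun i => hN _ (by omega)
    have h2 : m N ω ≤ ζ ω := le_ciSup (hbd ω) N
    linarith

lemma MemLinf.memLp {Ω : Type*} [MeasurableSpace Ω] {P : Measure Ω} [IsProbabilityMeasure P]
    {ξ : Ω → ℝ} (h : MemLinf ξ) : MemLp ξ 2 P := by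
  obtain ⟨hm, C, hC⟩ := h
  exact MemLp.of_bound hm.aestronglyMeasurable C (ae_of_all _ fun ω => by simpa using hC ω)

lemma inner_L2_eq {Ω : Type*} [MeasurableSpace Ω] {P : Measure Ω}
    (g f : Lp ℝ 2 P) {ξ : Ω → ℝ} (h : f =ᵐ[P] ξ) : inner ℝ g f = ∫ ω, g ω * ξ ω ∂P := by
  rw [L2.inner_def]
  refine integral_congr_ae ?_
  filter_upwards [h] with ω hω
  simp [hω, mul_comm]

lemma Lp2_integrable {Ω : Type*} [MeasurableSpace Ω] {P : Measure Ω} [IsProbabilityMeasure P]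
    (g : Lp ℝ 2 P) : Integrable (fun ω => g ω) P :=
  (Lp.memLp g).integrable (by norm_num)

lemma L1_bound {Ω : Type*} [MeasurableSpace Ω] {P : Measure Ω} [IsProbabilityMeasure P]
    (g : Lp ℝ 2 P) (r u : ℝ) (hr : 0 ≤ r)
    (h : ∀ b : Lp ℝ 2 P, (∀ᵐ ω ∂P, |b ω| ≤ r) → inner ℝ g b < u) :
    r * ∫ ω, |g ω| ∂P < u := by
  let ξ : Ω → ℝ := fun ω => if 0 ≤ g ω then r else -r
  have hξm : Measurable ξ := Measurable.ite
    (measurableSet_le measurable_const (Lp.stronglyMeasurable g).measurable)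
    measurable_const measurable_const
  have hξb : ∀ ω, |ξ ω| ≤ r := by
    intro ω
    simp only [ξ]
    split_ifs <;> simp [abs_of_nonneg hr]
  have hξ : MemLp ξ 2 P := MemLinf.memLp ⟨hξm, r, hξb⟩
  have h1 := h (hξ.toLp ξ) (by
    filter_upwards [hξ.coeFn_toLp] with ω hω
    rw [hω]; exact hξb ω)
  rw [inner_L2_eq g _ hξ.coeFn_toLp] at h1
  rw [← integral_const_mul]
  have h2 : ∀ ω, r * |g ω| = g ω * ξ ω := by
    intro ω
    simp only [ξ]
    split_ifs with h0
    · rw [abs_of_nonneg h0, mul_comm]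
    · rw [abs_of_neg (not_le.1 h0)]; ring
  simpa only [h2] using h1

lemma exists_ae_subseq {Ω : Type*} [MeasurableSpace Ω] {P : Measure Ω}
    (f : ℕ → Lp ℝ 2 P) (f' : Lp ℝ 2 P) (h : Tendsto f atTop (nhds f')) :
    ∃ ns : ℕ → ℕ, ∀ᵐ ω ∂P, Tendsto (fun i => f (ns i) ω) atTop (nhds (f' ω)) := by
  obtain ⟨ns, -, h2⟩ := (tendstoInMeasure_of_tendsto_Lp h).exists_seq_tendsto_ae
  exact ⟨ns, h2⟩

lemma ballB_closed {Ω : Type*} [MeasurableSpace Ω] {P : Measure Ω} (r : ℝ) :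
    IsClosed {b : Lp ℝ 2 P | ∀ᵐ ω ∂P, |b ω| ≤ r} := by
  refine IsSeqClosed.isClosed fun f f' hf h => ?_
  obtain ⟨ns, h2⟩ := exists_ae_subseq f f' h
  have h3 : ∀ᵐ ω ∂P, ∀ n, |f n ω| ≤ r := ae_all_iff.2 hf
  filter_upwards [h2, h3] with ω h4 h5
  exact le_of_tendsto' h4.abs fun n => h5 _

lemma combo_ae {Ω : Type*} [MeasurableSpace Ω] {P : Measure Ω} (f g : Lp ℝ 2 P) (a b : ℝ) :
    ∀ᵐ ω ∂P, (a • f + b • g : Lp ℝ 2 P) ω = a * f ω + b * g ω := by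
  filter_upwards [Lp.coeFn_add (a • f) (b • g), Lp.coeFn_smul a f, Lp.coeFn_smul b g]
    with ω h1 h2 h3
  rw [h1, Pi.add_apply, h2, h3]
  simp

lemma abs_combo_le {x y r a b : ℝ} (hx : |x| ≤ r) (hy : |y| ≤ r) (ha : 0 ≤ a) (hb : 0 ≤ b)
    (hab : a + b = 1) : |a * x + b * y| ≤ r := by
  rw [abs_le] at *
  have h : r = a * r + b * r := by rw [← add_mul, hab, one_mul]
  constructor <;> nlinarith [mul_le_mul_of_nonneg_left hx.1 ha, mul_le_mul_of_nonneg_left hx.2 ha,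
    mul_le_mul_of_nonneg_left hy.1 hb, mul_le_mul_of_nonneg_left hy.2 hb]

lemma ballB_convex {Ω : Type*} [MeasurableSpace Ω] {P : Measure Ω} (r : ℝ) :
    Convex ℝ {b : Lp ℝ 2 P | ∀ᵐ ω ∂P, |b ω| ≤ r} := by
  intro f hf g hg a b ha hb hab
  filter_upwards [hf, hg, combo_ae f g a b] with ω h1 h2 h3
  rw [h3]
  exact abs_combo_le h1 h2 ha hb hab

lemma norm_le_of_ae {Ω : Type*} [MeasurableSpace Ω] {P : Measure Ω} [IsProbabilityMeasure P]
    (f : Lp ℝ 2 P) (r : ℝ) (hr : 0 ≤ r) (h : ∀ᵐ ω ∂P, |f ω| ≤ r) : ‖f‖ ≤ r := by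
  have := Lp.norm_le_of_ae_bound (f := f) hr h
  simpa [measureUnivNNReal] using this

section KS
variable {Ω : Type*} [MeasurableSpace Ω] {P : Measure Ω} [IsProbabilityMeasure P]

lemma ks_seq (A : Set (Ω → ℝ)) (hA : ∀ ξ ∈ A, MemLinf ξ)
    (hconv : ∀ ξ ∈ A, ∀ η ∈ A, ∀ a b : ℝ, 0 ≤ a → 0 ≤ b → a + b = 1 →
      (fun ω => a * ξ ω + b * η ω) ∈ A)
    (hup : ∀ ξ ∈ A, ∀ η, MemLinf η → ξ ≤ᵐ[P] η → η ∈ A)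
    (hcl : ∀ (ξ : ℕ → Ω → ℝ) (R : ℝ), (∀ n, ξ n ∈ A) → (∀ n ω, |ξ n ω| ≤ R) →
      ∃ ζ ∈ A, ∀ ω x, Tendsto (fun n => ξ n ω) atTop (nhds x) → ζ ω = x)
    (ε : ℝ) (hε : 0 < ε) (hsmall : ∀ ξ ∈ A, ¬ ∀ ω, |ξ ω| ≤ ε) :
    ∃ g : ℕ → Lp ℝ 2 P, (∀ n, ∫ ω, |g n ω| ∂P ≤ 2 / (ε * 2 ^ n)) ∧
      ∀ ξ ∈ A, ∃ n, 1 < ∫ ω, g n ω * ξ ω ∂P := by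
  let C : ℕ → Set (Lp ℝ 2 P) := fun n => {f | (∃ ξ ∈ A, f =ᵐ[P] ξ) ∧ ∀ᵐ ω ∂P, |f ω| ≤ ε * 2 ^ n}
  have hrpos : ∀ n : ℕ, 0 < ε * 2 ^ n := fun n => by positivity
  -- clipping
  have hclip : ∀ ξ ∈ A, ∀ r : ℝ, 0 ≤ r → (∀ᵐ ω ∂P, |ξ ω| ≤ r) →
      ∃ η ∈ A, ξ =ᵐ[P] η ∧ ∀ ω, |η ω| ≤ r := by
    intro ξ hξ r hr h
    have he : ξ =ᵐ[P] fun ω => max (-r) (min r (ξ ω)) := by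
      filter_upwards [h] with ω hω
      rw [abs_le] at hω
      rw [min_eq_right hω.2, max_eq_right hω.1]
    have hb : ∀ ω, |max (-r) (min r (ξ ω))| ≤ r := fun ω =>
      abs_le.2 ⟨le_max_left _ _, max_le (by linarith) (min_le_left _ _)⟩
    exact ⟨_, hup ξ hξ _ ⟨measurable_const.max (measurable_const.min (hA ξ hξ).1), r, hb⟩ he.le,
      he, hb⟩
  have hCclosed : ∀ n, IsClosed (C n) := by
    intro n
    refine IsSeqClosed.isClosed fun f f' hf h => ?_
    have hb : ∀ᵐ ω ∂P, |f' ω| ≤ ε * 2 ^ n :=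
      (ballB_closed (P := P) (ε * 2 ^ n)).isSeqClosed (fun k => (hf k).2) h
    refine ⟨?_, hb⟩
    have h1 : ∀ k, ∃ η ∈ A, f k =ᵐ[P] η ∧ ∀ ω, |η ω| ≤ ε * 2 ^ n := by
      intro k
      obtain ⟨⟨ξ, hξ, h2⟩, h3⟩ := hf k
      obtain ⟨η, hη, h4, h5⟩ := hclip ξ hξ _ (hrpos n).le (by
        filter_upwards [h2, h3] with ω h6 h7
        rwa [← h6])
      exact ⟨η, hη, h2.trans h4, h5⟩
    choose η hη hfη hηb using h1
    obtain ⟨ns, hns⟩ := exists_ae_subseq f f' h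
    obtain ⟨ζ, hζ, hζl⟩ := hcl (fun i => η (ns i)) _ (fun i => hη _) (fun i => hηb _)
    refine ⟨ζ, hζ, ?_⟩
    have h6 : ∀ᵐ ω ∂P, ∀ k, f k ω = η k ω := ae_all_iff.2 hfη
    filter_upwards [hns, h6] with ω h7 h8
    refine (hζl ω _ ?_).symm
    simpa only [h8] using h7
  have hCconv : ∀ n, Convex ℝ (C n) := by
    intro n f hf g hg a b ha hb hab
    refine ⟨?_, ballB_convex (P := P) _ hf.2 hg.2 ha hb hab⟩
    obtain ⟨ξ, hξ, h1⟩ := hf.1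
    obtain ⟨η, hη, h2⟩ := hg.1
    refine ⟨_, hconv ξ hξ η hη a b ha hb hab, ?_⟩
    filter_upwards [combo_ae f g a b, h1, h2] with ω h3 h4 h5
    rw [h3, h4, h5]
  let T : ℕ → Type _ := fun n => {S : Set (Lp ℝ 2 P) // IsClosed S ∧ Convex ℝ S ∧ Disjoint (C n) S}
  have step : ∀ (n : ℕ) (S : T n), ∃ g : Lp ℝ 2 P, ∫ ω, |g ω| ∂P ≤ 2 / (ε * 2 ^ n) ∧
      Disjoint (C (n + 1)) (S.1 ∩ {f | inner ℝ g f ≤ 1}) := by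
    rintro n ⟨S, hS1, hS2, hS3⟩
    obtain ⟨g, u, h1, h2⟩ := sep_hilbert (C (n + 1) ∩ S) {b : Lp ℝ 2 P | ∀ᵐ ω ∂P, |b ω| ≤ ε * 2 ^ n}
      ((hCclosed _).inter hS1) ((hCconv _).inter hS2) (ε * 2 ^ (n + 1))
      (fun x hx => norm_le_of_ae x _ (hrpos _).le hx.1.2) (ballB_closed _) (ballB_convex _) (by
        rw [Set.disjoint_left]
        rintro f ⟨hf1, hf2⟩ hf3
        exact Set.disjoint_left.1 hS3 ⟨hf1.1, hf3⟩ hf2)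
    have h3 := L1_bound g _ u (hrpos n).le h1
    have hint : 0 ≤ ∫ ω, |g ω| ∂P := integral_nonneg fun ω => abs_nonneg _
    have hu : 0 < u := lt_of_le_of_lt (mul_nonneg (hrpos n).le hint) h3
    refine ⟨(2 / u) • g, ?_, ?_⟩
    · have : ∫ ω, |((2 / u) • g : Lp ℝ 2 P) ω| ∂P = (2 / u) * ∫ ω, |g ω| ∂P := by
        rw [← integral_const_mul]
        refine integral_congr_ae ?_
        filter_upwards [Lp.coeFn_smul (2 / u) g] with ω hω
        rw [hω, Pi.smul_apply, smul_eq_mul, abs_mul, abs_of_pos (by positivity)]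
      rw [this, div_mul_eq_mul_div, div_le_div_iff₀ hu (hrpos n)]
      nlinarith
    · rw [Set.disjoint_left]
      rintro f hf1 ⟨hf2, hf3⟩
      have h4 := h2 f ⟨hf1, hf2⟩
      simp only [Set.mem_ofPred_eq, real_inner_smul_left] at hf3
      have h5 : 2 / u * u ≤ 2 / u * inner ℝ g f := by gcongr
      rw [div_mul_cancel₀ _ hu.ne'] at h5
      linarith
  choose G hG1 hG2 using step
  let seq : (n : ℕ) → T n := fun n => Nat.rec (motive := T)
    ⟨Set.univ, isClosed_univ, convex_univ, by
      rw [Set.disjoint_left]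
      rintro f ⟨⟨ξ, hξ, h1⟩, h2⟩ -
      obtain ⟨η, hη, -, h4⟩ := hclip ξ hξ ε hε.le (by
        filter_upwards [h1, h2] with ω h6 h7
        rw [← h6]; simpa using h7)
      exact hsmall η hη h4⟩
    (fun n s => ⟨s.1 ∩ {f | inner ℝ (G n s) f ≤ 1},
      s.2.1.inter (isClosed_le (by fun_prop) continuous_const),
      s.2.2.1.inter (by
        intro f hf g hg a b ha hb hab
        simp only [Set.mem_ofPred_eq, inner_add_right, real_inner_smul_right] at *
        nlinarith [mul_le_mul_of_nonneg_left hf ha, mul_le_mul_of_nonneg_left hg hb]), hG2 n s⟩) n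
  refine ⟨fun n => G n (seq n), fun n => hG1 n _, fun ξ hξ => ?_⟩
  by_contra! hcon
  have hL : MemLp ξ 2 P := (hA ξ hξ).memLp
  have hmem : ∀ n, hL.toLp ξ ∈ (seq n).1 := by
    intro n
    induction n with
    | zero => exact Set.mem_univ _
    | succ n ih =>
      refine ⟨ih, ?_⟩
      have := hcon n
      rw [← inner_L2_eq _ _ hL.coeFn_toLp] at this
      exact this
  obtain ⟨R, hR⟩ := (hA ξ hξ).2
  obtain ⟨n, hn⟩ := pow_unbounded_of_one_lt (R / ε) (one_lt_two)
  refine (Set.disjoint_left.1 (seq n).2.2.2 : ∀ ⦃a⦄, a ∈ C n → a ∉ (seq n).1) ⟨⟨ξ, hξ, hL.coeFn_toLp⟩, ?_⟩ (hmem n)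
  filter_upwards [hL.coeFn_toLp] with ω hω
  rw [hω]
  rw [div_lt_iff₀ hε] at hn
  linarith [hR ω]

lemma ks_density (A : Set (Ω → ℝ)) (hA : ∀ ξ ∈ A, MemLinf ξ)
    (hconv : ∀ ξ ∈ A, ∀ η ∈ A, ∀ a b : ℝ, 0 ≤ a → 0 ≤ b → a + b = 1 →
      (fun ω => a * ξ ω + b * η ω) ∈ A)
    (ε : ℝ) (hε : 0 < ε) (g : ℕ → Lp ℝ 2 P)
    (hg : ∀ n, ∫ ω, |g n ω| ∂P ≤ 2 / (ε * 2 ^ n))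
    (h1 : ∀ ξ ∈ A, ∃ n, 1 < ∫ ω, g n ω * ξ ω ∂P) :
    ∃ (q : Ω → ℝ) (s : ℝ), 0 < s ∧ ∀ ξ ∈ A, s ≤ ∫ ω, q ω * ξ ω ∂P := by
  have hgeo : Summable fun n : ℕ => 2 / (ε * 2 ^ n) := by
    have : (fun n : ℕ => 2 / (ε * 2 ^ n)) = fun n : ℕ => (2 / ε) * (1 / 2 : ℝ) ^ n := by
      ext n
      rw [one_div, inv_pow]
      field_simp
    rw [this]
    exact (summable_geometric_two).mul_left _
  have hgi : ∀ n, Integrable (fun ω => g n ω) P := fun n => Lp2_integrable _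
  have hmi : ∀ n ξ, MemLinf ξ → Integrable (fun ω => g n ω * ξ ω) P := by
    rintro n ξ ⟨hm, C, hC⟩
    exact (hgi n).mul_bdd hm.aestronglyMeasurable (c := C) (ae_of_all _ hC)
  have hsumm : ∀ ξ, MemLinf ξ → Summable fun n => ∫ ω, |g n ω * ξ ω| ∂P := by
    rintro ξ ⟨hm, C, hC⟩
    refine Summable.of_nonneg_of_le (fun n => integral_nonneg fun ω => abs_nonneg _) (fun n => ?_)
      (hgeo.mul_left C)
    have hC0 : 0 ≤ C := by
      obtain ⟨ω⟩ := P.nonempty_of_neZero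
      exact (abs_nonneg _).trans (hC ω)
    calc ∫ ω, |g n ω * ξ ω| ∂P ≤ ∫ ω, C * |g n ω| ∂P := by
          refine integral_mono (hmi n ξ ⟨hm, C, hC⟩).abs ((hgi n).abs.const_mul C) fun ω => ?_
          dsimp only
          rw [abs_mul, mul_comm]
          exact mul_le_mul_of_nonneg_right (hC ω) (abs_nonneg _)
      _ = C * ∫ ω, |g n ω| ∂P := integral_const_mul _ _
      _ ≤ _ := mul_le_mul_of_nonneg_left (hg n) hC0
  let TA : Set (lp (fun _ : ℕ => ℝ) 2) := {a | ∃ ξ ∈ A, ∀ n, a n = ∫ ω, g n ω * ξ ω ∂P}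
  have hTAconv : Convex ℝ TA := by
    rintro x ⟨ξ, hξ, hx⟩ y ⟨η, hη, hy⟩ a b ha hb hab
    refine ⟨_, hconv ξ hξ η hη a b ha hb hab, fun n => ?_⟩
    simp only [lp.coeFn_add, lp.coeFn_smul, Pi.add_apply, Pi.smul_apply, smul_eq_mul, hx, hy]
    rw [← integral_const_mul, ← integral_const_mul,
      ← integral_add ((hmi n ξ (hA ξ hξ)).const_mul a) ((hmi n η (hA η hη)).const_mul b)]
    congr 1
    ext ω
    ring
  obtain ⟨φ, u, h2, h3⟩ := geometric_hahn_banach_open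
    (convex_ball (0 : lp (fun _ : ℕ => ℝ) 2) 1) Metric.isOpen_ball hTAconv (by
      rw [Set.disjoint_left]
      rintro a ha ⟨ξ, hξ, hx⟩
      obtain ⟨n, hn⟩ := h1 ξ hξ
      rw [← hx n] at hn
      have h4 := lp.norm_apply_le_norm (by norm_num) a n
      rw [mem_ball_zero_iff] at ha
      rw [Real.norm_eq_abs] at h4
      linarith [le_abs_self (a n)])
  have hu : 0 < u := by simpa using h2 0 (by simp)
  let l := (InnerProductSpace.toDual ℝ (lp (fun _ : ℕ => ℝ) 2)).symm φ
  refine ⟨fun ω => ∑' n, l n * g n ω, u, hu, fun ξ hξ => ?_⟩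
  have hξ' := hA ξ hξ
  have hmem : Memℓp (fun n => ∫ ω, g n ω * ξ ω ∂P) 2 := by
    have : Memℓp (fun n => ∫ ω, g n ω * ξ ω ∂P) 1 := by
      refine memℓp_gen ?_
      simp only [ENNReal.toReal_one, Real.rpow_one]
      refine Summable.of_nonneg_of_le (fun n => norm_nonneg _) (fun n => ?_) (hsumm ξ hξ')
      exact norm_integral_le_integral_norm _
    exact this.of_exponent_ge (by norm_num)
  let a : lp (fun _ : ℕ => ℝ) 2 := ⟨_, hmem⟩
  have h5 := h3 a ⟨ξ, hξ, fun n => rfl⟩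
  have h6 : φ a = inner ℝ l a := (InnerProductSpace.toDual_symm_apply).symm
  rw [h6, lp.inner_eq_tsum] at h5
  have h7 := hasSum_integral_of_summable_integral_norm (μ := P)
    (F := fun n ω => l n * (g n ω * ξ ω)) (fun n => (hmi n ξ hξ').const_mul _) (by
      refine Summable.of_nonneg_of_le (fun n => integral_nonneg fun ω => norm_nonneg _)
        (fun n => ?_) ((hsumm ξ hξ').mul_left ‖l‖)
      simp only [norm_mul (l _)]
      rw [integral_const_mul]
      exact mul_le_mul_of_nonneg_right (lp.norm_apply_le_norm (by norm_num) l n)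
        (integral_nonneg fun ω => norm_nonneg _))
  calc u ≤ _ := h5
    _ = ∑' n, ∫ ω, l n * (g n ω * ξ ω) ∂P := by
      refine tsum_congr fun n => ?_
      rw [integral_const_mul]
      simp [a, mul_comm]
    _ = ∫ ω, ∑' n, l n * (g n ω * ξ ω) ∂P := h7.tsum_eq
    _ = _ := by
      congr 1
      ext ω
      rw [← tsum_mul_right]
      simp only [mul_assoc]

end KS

lemma MemLinf.sub {Ω : Type*} [MeasurableSpace Ω] {ξ η : Ω → ℝ} (h : MemLinf ξ)
    (h' : MemLinf η) : MemLinf (fun ω => ξ ω - η ω) := by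
  obtain ⟨hm, C, hC⟩ := h
  obtain ⟨hm', C', hC'⟩ := h'
  refine ⟨hm.sub hm', C + C', fun ω => ?_⟩
  exact (abs_sub _ _).trans (add_le_add (hC ω) (hC' ω))

lemma MemLinf.add {Ω : Type*} [MeasurableSpace Ω] {ξ η : Ω → ℝ} (h : MemLinf ξ)
    (h' : MemLinf η) : MemLinf (fun ω => ξ ω + η ω) := by
  obtain ⟨hm, C, hC⟩ := h
  obtain ⟨hm', C', hC'⟩ := h'
  refine ⟨hm.add hm', C + C', fun ω => ?_⟩
  exact (abs_add_le _ _).trans (add_le_add (hC ω) (hC' ω))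

lemma MemLinf.const_mul {Ω : Type*} [MeasurableSpace Ω] {ξ : Ω → ℝ} (h : MemLinf ξ)
    (a : ℝ) : MemLinf (fun ω => a * ξ ω) := by
  obtain ⟨hm, C, hC⟩ := h
  refine ⟨hm.const_mul a, |a| * C, fun ω => ?_⟩
  rw [abs_mul]
  exact mul_le_mul_of_nonneg_left (hC ω) (abs_nonneg _)

lemma memLinf_const {Ω : Type*} [MeasurableSpace Ω] (c : ℝ) : MemLinf (fun _ : Ω => c) :=
  ⟨measurable_const, |c|, fun _ => le_rfl⟩

lemma MemLinf.integrable {Ω : Type*} [MeasurableSpace Ω] {Q : Measure Ω} [IsProbabilityMeasure Q]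
    {ξ : Ω → ℝ} (h : MemLinf ξ) : Integrable ξ Q :=
  (h.memLp (P := Q)).integrable (by norm_num)

lemma exists_measure {Ω : Type*} [MeasurableSpace Ω] (P : MeasureTheory.Measure Ω)
    [IsProbabilityMeasure P] (ℰ : (Ω → ℝ) → ℝ)
    (hmono : ∀ ξ₁ ξ₂ : Ω → ℝ, MemLinf ξ₁ → MemLinf ξ₂ → (ξ₂ ≤ᵐ[P] ξ₁) → ℰ ξ₂ ≤ ℰ ξ₁)
    (htrans : ∀ ξ : Ω → ℝ, MemLinf ξ → ∀ c : ℝ,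
      ℰ (fun ω => ξ ω + c) = ℰ ξ + c)
    (hconvex : ∀ ξ₁ ξ₂ : Ω → ℝ, MemLinf ξ₁ → MemLinf ξ₂ →
      ∀ t : ℝ, 0 ≤ t → t ≤ 1 →
        ℰ (fun ω => t * ξ₁ ω + (1 - t) * ξ₂ ω) ≤ t * ℰ ξ₁ + (1 - t) * ℰ ξ₂)
    (hlsc : ∀ (ξs : ℕ → Ω → ℝ) (ξ : Ω → ℝ), (∀ n, MemLinf (ξs n)) → MemLinf ξ →
      (∀ ω, Monotone fun n => ξs n ω) →
      (∀ ω, Tendsto (fun n => ξs n ω) atTop (nhds (ξ ω))) →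
        Tendsto (fun n => ℰ (ξs n)) atTop (nhds (ℰ ξ)))
    (ξ₀ : Ω → ℝ) (hξ₀ : MemLinf ξ₀) (c : ℝ) (hc : c < ℰ ξ₀) :
    ∃ Q : Measure Ω, (IsProbabilityMeasure Q ∧ Q ≪ P) ∧
      ∀ η, MemLinf η → ∫ ω, η ω ∂Q - ℰ η ≤ ∫ ω, ξ₀ ω ∂Q - c := by
  let A : Set (Ω → ℝ) := {ξ | MemLinf ξ ∧ ℰ (fun ω => ξ₀ ω - ξ ω) ≤ c}
  have hA : ∀ ξ ∈ A, MemLinf ξ := fun ξ h => h.1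
  have hconv : ∀ ξ ∈ A, ∀ η ∈ A, ∀ a b : ℝ, 0 ≤ a → 0 ≤ b → a + b = 1 →
      (fun ω => a * ξ ω + b * η ω) ∈ A := by
    rintro ξ ⟨hξ, h1⟩ η ⟨hη, h2⟩ a b ha hb hab
    refine ⟨(hξ.const_mul a).add (hη.const_mul b), ?_⟩
    obtain rfl : b = 1 - a := by linarith
    have h3 := hconvex _ _ (hξ₀.sub hξ) (hξ₀.sub hη) a ha (by linarith)
    have h4 : (fun ω => ξ₀ ω - (a * ξ ω + (1 - a) * η ω)) =
        fun ω => a * (ξ₀ ω - ξ ω) + (1 - a) * (ξ₀ ω - η ω) := by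
      ext ω; ring
    rw [h4]
    nlinarith [mul_le_mul_of_nonneg_left h1 ha, mul_le_mul_of_nonneg_left h2 hb]
  have hup : ∀ ξ ∈ A, ∀ η, MemLinf η → ξ ≤ᵐ[P] η → η ∈ A := by
    rintro ξ ⟨hξ, h1⟩ η hη h
    refine ⟨hη, (hmono _ _ (hξ₀.sub hξ) (hξ₀.sub hη) ?_).trans h1⟩
    filter_upwards [h] with ω hω
    linarith
  have hcl : ∀ (ξ : ℕ → Ω → ℝ) (R : ℝ), (∀ n, ξ n ∈ A) → (∀ n ω, |ξ n ω| ≤ R) →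
      ∃ ζ ∈ A, ∀ ω x, Tendsto (fun n => ξ n ω) atTop (nhds x) → ζ ω = x := by
    intro ξ R h1 h2
    obtain ⟨R₀, hR₀⟩ := hξ₀.2
    obtain ⟨ζ, hζ, h3, h4⟩ := fatou_seq ℰ
      (fun ξ₁ ξ₂ g1 g2 g3 => hmono ξ₁ ξ₂ g1 g2 (ae_of_all _ g3)) hlsc
      (fun n ω => ξ₀ ω - ξ n ω) (fun n => hξ₀.1.sub (h1 n).1.1) (R₀ + R) c
      (fun n ω => (abs_sub _ _).trans (add_le_add (hR₀ ω) (h2 n ω))) (fun n => (h1 n).2)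
    refine ⟨fun ω => ξ₀ ω - ζ ω, ⟨hξ₀.sub hζ, ?_⟩, fun ω x hx => ?_⟩
    · simpa using h3
    · have := h4 ω (ξ₀ ω - x) (hx.const_sub _)
      simp [this]
  have hconstA : ∀ η, MemLinf η → (fun ω => ξ₀ ω - η ω + (ℰ η - c)) ∈ A := by
    intro η hη
    refine ⟨(hξ₀.sub hη).add (memLinf_const _), ?_⟩
    have h4 : (fun ω => ξ₀ ω - (ξ₀ ω - η ω + (ℰ η - c))) = fun ω => η ω + (c - ℰ η) := by
      ext ω; ring
    rw [h4, htrans η hη]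
    linarith
  have hsmall : ∀ ξ ∈ A, ¬ ∀ ω, |ξ ω| ≤ (ℰ ξ₀ - c) / 2 := by
    rintro ξ ⟨hξ, h1⟩ h
    have h2 := htrans ξ₀ hξ₀ (-((ℰ ξ₀ - c) / 2))
    have h3 := hmono _ _ (hξ₀.sub hξ) (hξ₀.add (memLinf_const (-((ℰ ξ₀ - c) / 2))))
      (ae_of_all _ fun ω => by
        have := (abs_le.1 (h ω)).2
        dsimp only
        linarith)
    linarith
  have hε : 0 < (ℰ ξ₀ - c) / 2 := by linarith
  obtain ⟨g, hg, hg1⟩ := ks_seq (P := P) A hA hconv hup hcl _ hε hsmall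
  obtain ⟨q, s, hs, hq⟩ := ks_density (P := P) A hA hconv _ hε g hg hg1
  -- a positive constant in A
  have hM : (fun _ : Ω => ℰ ξ₀ - c) ∈ A := by
    have := hconstA ξ₀ hξ₀
    simpa using this
  set M := ℰ ξ₀ - c with hMdef
  have hMpos : 0 < M := by linarith
  have hqM : s ≤ (∫ ω, q ω ∂P) * M := by
    have := hq _ hM
    rwa [integral_mul_const] at this
  have hI : 0 < ∫ ω, q ω ∂P := by
    by_contra! h
    nlinarith
  have hqi : Integrable q P := by
    by_contra h
    rw [integral_undef h] at hI
    exact lt_irrefl _ hI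
  have hq0 : 0 ≤ᵐ[P] q := by
    refine ae_nonneg_of_forall_setIntegral_nonneg hqi fun S hS _ => ?_
    by_contra! hneg
    obtain ⟨t, ht0, ht⟩ : ∃ t : ℝ, 0 ≤ t ∧ (∫ ω, q ω ∂P) * M + t * ∫ ω in S, q ω ∂P ≤ 0 := by
      refine ⟨((∫ ω, q ω ∂P) * M) / (- ∫ ω in S, q ω ∂P), ?_, ?_⟩
      · exact div_nonneg (mul_nonneg hI.le hMpos.le) (by linarith)
      · have : (∫ ω in S, q ω ∂P) ≠ 0 := hneg.ne
        field_simp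
        simp
    have hind : MemLinf (S.indicator fun _ : Ω => (1 : ℝ)) :=
      ⟨measurable_const.indicator hS, 1, fun ω => by
        by_cases h : ω ∈ S <;> simp [h]⟩
    have h1 := hq _ (hup _ hM (fun ω => M + t * S.indicator (fun _ => (1 : ℝ)) ω)
      ((memLinf_const M).add (hind.const_mul t)) (ae_of_all _ fun ω => by
        have : 0 ≤ S.indicator (fun _ => (1 : ℝ)) ω := Set.indicator_nonneg (fun _ _ => zero_le_one) _
        dsimp only
        nlinarith [mul_nonneg ht0 this]))
    have h2 : (fun ω => q ω * (M + t * S.indicator (fun _ => (1 : ℝ)) ω)) =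
        fun ω => q ω * M + t * S.indicator q ω := by
      ext ω
      by_cases h : ω ∈ S <;> simp [h] ; ring
    rw [h2, integral_add (hqi.mul_const M) ((hqi.indicator hS).const_mul t), integral_mul_const,
      integral_const_mul, integral_indicator hS] at h1
    linarith
  set I := ∫ ω, q ω ∂P with hIdef
  have hqm : AEMeasurable (fun ω => ENNReal.ofReal (q ω / I)) P :=
    (hqi.aestronglyMeasurable.aemeasurable.div_const I).ennreal_ofReal
  let Q : Measure Ω := P.withDensity fun ω => ENNReal.ofReal (q ω / I)
  have hQint : ∀ ξ : Ω → ℝ, ∫ ω, ξ ω ∂Q = (∫ ω, q ω * ξ ω ∂P) / I := by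
    intro ξ
    rw [integral_withDensity_eq_integral_toReal_smul₀ hqm (ae_of_all _ fun ω => ENNReal.ofReal_lt_top),
      ← integral_div]
    refine integral_congr_ae ?_
    filter_upwards [hq0] with ω hω
    have : 0 ≤ q ω / I := div_nonneg hω hI.le
    rw [ENNReal.toReal_ofReal this, smul_eq_mul]
    ring
  have hQP : IsProbabilityMeasure Q := by
    constructor
    rw [withDensity_apply _ MeasurableSet.univ, Measure.restrict_univ,
      ← ofReal_integral_eq_lintegral_ofReal (hqi.div_const I), integral_div, div_self hI.ne',
      ENNReal.ofReal_one]
    filter_upwards [hq0] with ω hω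
    exact div_nonneg hω hI.le
  refine ⟨Q, ⟨hQP, withDensity_absolutelyContinuous _ _⟩, fun η hη => ?_⟩
  have h1 := hq _ (hconstA η hη)
  have h2 : 0 ≤ ∫ ω, (ξ₀ ω - η ω + (ℰ η - c)) ∂Q := by
    rw [hQint]
    exact div_nonneg (hs.le.trans h1) hI.le
  rw [integral_add (hξ₀.sub hη).integrable (integrable_const _),
    integral_sub hξ₀.integrable hη.integrable] at h2
  simp at h2
  linarith

theorem convex_expectation_representation
    {Ω : Type*} [MeasurableSpace Ω] (P : MeasureTheory.Measure Ω)
    [IsProbabilityMeasure P] (ℰ : (Ω → ℝ) → ℝ)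
    -- strict monotonicity:
    (hmono : ∀ ξ₁ ξ₂ : Ω → ℝ, MemLinf ξ₁ → MemLinf ξ₂ → (ξ₂ ≤ᵐ[P] ξ₁) →
      ℰ ξ₂ ≤ ℰ ξ₁ ∧ (ℰ ξ₁ = ℰ ξ₂ → ξ₁ =ᵐ[P] ξ₂))
    -- constant triviality:
    (hconst : ∀ c : ℝ, ℰ (fun _ => c) = c)
    -- translation equivariance:
    (htrans : ∀ ξ : Ω → ℝ, MemLinf ξ → ∀ c : ℝ,
      ℰ (fun ω => ξ ω + c) = ℰ ξ + c)
    -- convexity: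
    (hconvex : ∀ ξ₁ ξ₂ : Ω → ℝ, MemLinf ξ₁ → MemLinf ξ₂ →
      ∀ t : ℝ, 0 ≤ t → t ≤ 1 →
        ℰ (fun ω => t * ξ₁ ω + (1 - t) * ξ₂ ω) ≤ t * ℰ ξ₁ + (1 - t) * ℰ ξ₂)
    -- lower semicontinuity:
    (hlsc : ∀ (ξs : ℕ → Ω → ℝ) (ξ : Ω → ℝ), (∀ n, MemLinf (ξs n)) → MemLinf ξ →
      (∀ ω, Monotone fun n => ξs n ω) →
      (∀ ω, Tendsto (fun n => ξs n ω) atTop (nhds (ξ ω))) →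
      Monotone (fun n => ℰ (ξs n)) ∧
        Tendsto (fun n => ℰ (ξs n)) atTop (nhds (ℰ ξ))) :
    -- conclusion: existence of a minimal penalty function on
    -- `ℳ₁ = {Q : probability measure, Q ≪ P}` representing `ℰ`
    ∃ αmin : {Q : MeasureTheory.Measure Ω // IsProbabilityMeasure Q ∧ Q ≪ P}
        → ℝ≥0∞,
      (∀ ξ : Ω → ℝ, MemLinf ξ →
        ((ℰ ξ : ℝ) : EReal)
          = ⨆ Q : {Q : MeasureTheory.Measure Ω // IsProbabilityMeasure Q ∧ Q ≪ P},
              (((∫ ω, ξ ω ∂(Q : MeasureTheory.Measure Ω) : ℝ) : EReal)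
                - ((αmin Q : ℝ≥0∞) : EReal))) ∧
      (∀ Q : {Q : MeasureTheory.Measure Ω // IsProbabilityMeasure Q ∧ Q ≪ P},
        ((αmin Q : ℝ≥0∞) : EReal)
          = ⨆ ξ : {ξ : Ω → ℝ // MemLinf ξ},
              (((∫ ω, (ξ : Ω → ℝ) ω ∂(Q : MeasureTheory.Measure Ω) : ℝ) : EReal)
                - ((ℰ ξ : ℝ) : EReal))) ∧
      (∀ α : {Q : MeasureTheory.Measure Ω // IsProbabilityMeasure Q ∧ Q ≪ P}
          → ℝ≥0∞,
        (∀ ξ : Ω → ℝ, MemLinf ξ →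
          ((ℰ ξ : ℝ) : EReal)
            = ⨆ Q : {Q : MeasureTheory.Measure Ω // IsProbabilityMeasure Q ∧ Q ≪ P},
                (((∫ ω, ξ ω ∂(Q : MeasureTheory.Measure Ω) : ℝ) : EReal)
                  - ((α Q : ℝ≥0∞) : EReal))) →
        ∀ Q, αmin Q ≤ α Q) := by
  have hmono' : ∀ ξ₁ ξ₂ : Ω → ℝ, MemLinf ξ₁ → MemLinf ξ₂ → (ξ₂ ≤ᵐ[P] ξ₁) → ℰ ξ₂ ≤ ℰ ξ₁ :=
    fun ξ₁ ξ₂ h1 h2 h3 => (hmono ξ₁ ξ₂ h1 h2 h3).1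
  have hlsc' : ∀ (ξs : ℕ → Ω → ℝ) (ξ : Ω → ℝ), (∀ n, MemLinf (ξs n)) → MemLinf ξ →
      (∀ ω, Monotone fun n => ξs n ω) →
      (∀ ω, Tendsto (fun n => ξs n ω) atTop (nhds (ξ ω))) →
        Tendsto (fun n => ℰ (ξs n)) atTop (nhds (ℰ ξ)) :=
    fun ξs ξ h1 h2 h3 h4 => (hlsc ξs ξ h1 h2 h3 h4).2
  let β : {Q : MeasureTheory.Measure Ω // IsProbabilityMeasure Q ∧ Q ≪ P} → EReal := fun Q =>
    ⨆ ξ : {ξ : Ω → ℝ // MemLinf ξ},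
      (((∫ ω, (ξ : Ω → ℝ) ω ∂(Q : MeasureTheory.Measure Ω) : ℝ) : EReal) - ((ℰ ξ : ℝ) : EReal))
  have hβ0 : ∀ Q, 0 ≤ β Q := by
    intro Q
    refine le_trans ?_ (le_iSup _ (⟨fun _ => 0, memLinf_const 0⟩ : {ξ : Ω → ℝ // MemLinf ξ}))
    simp [hconst 0]
  have hcoe : ∀ Q, (((β Q).toENNReal : ℝ≥0∞) : EReal) = β Q := fun Q =>
    EReal.coe_toENNReal (hβ0 Q)
  refine ⟨fun Q => (β Q).toENNReal, ?_, fun Q => hcoe Q, ?_⟩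
  · intro ξ hξ
    simp only [hcoe]
    apply le_antisymm
    · refine EReal.ge_of_forall_gt_iff_ge.1 fun c hc => ?_
      have hc' : c < ℰ ξ := by exact_mod_cast hc
      obtain ⟨Q, hQ, h⟩ := exists_measure P ℰ hmono' htrans hconvex hlsc' ξ hξ c hc'
      refine le_trans ?_ (le_iSup _
        (⟨Q, hQ⟩ : {Q : MeasureTheory.Measure Ω // IsProbabilityMeasure Q ∧ Q ≪ P}))
      have hb : β ⟨Q, hQ⟩ ≤ ((∫ ω, ξ ω ∂Q - c : ℝ) : EReal) := by
        refine iSup_le fun η => ?_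
        exact_mod_cast h η.1 η.2
      have h2 : ((∫ ω, ξ ω ∂Q : ℝ) : EReal) - ((∫ ω, ξ ω ∂Q - c : ℝ) : EReal) = (c : EReal) := by
        norm_cast
        congr 1
        ring
      rw [← h2]
      exact EReal.sub_le_sub le_rfl hb
    · refine iSup_le fun Q => ?_
      have h1 : ((∫ ω, ξ ω ∂(Q : Measure Ω) : ℝ) : EReal) - ((ℰ ξ : ℝ) : EReal) ≤ β Q :=
        le_iSup (fun ξ : {ξ : Ω → ℝ // MemLinf ξ} =>
          (((∫ ω, (ξ : Ω → ℝ) ω ∂(Q : MeasureTheory.Measure Ω) : ℝ) : EReal)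
            - ((ℰ ξ : ℝ) : EReal))) ⟨ξ, hξ⟩
      rw [EReal.sub_le_iff_le_add (.inl (EReal.coe_ne_bot _)) (.inl (EReal.coe_ne_top _))] at h1
      exact EReal.sub_le_of_le_add' h1
  · intro α hα Q
    rw [← EReal.coe_ennreal_le_coe_ennreal_iff, hcoe]
    refine iSup_le fun ξ => ?_
    have h1 : ((∫ ω, ξ.1 ω ∂(Q : Measure Ω) : ℝ) : EReal) - ((α Q : ℝ≥0∞) : EReal) ≤ ℰ ξ.1 := by
      rw [hα ξ.1 ξ.2]
      exact le_iSup (fun Q : {Q : MeasureTheory.Measure Ω // IsProbabilityMeasure Q ∧ Q ≪ P} =>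
        ((∫ ω, ξ.1 ω ∂(Q : Measure Ω) : ℝ) : EReal) - ((α Q : ℝ≥0∞) : EReal)) Q
    rw [EReal.sub_le_iff_le_add (.inr (EReal.coe_ne_top _)) (.inr (EReal.coe_ne_bot _))] at h1
    exact EReal.sub_le_of_le_add' h1
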